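/- arXiv:1402.1436 — 3 statements merged into one kernel-verified Lean document; each statement's English description precedes it below -/
import Mathlib

section
/- Let n ≥ 1, let P₀, P₁, …, P_m be n×n unitary matrices and c₀, c₁, …, c_m be real numbers. Consider the optimization problem of maximizing X ↦ min_{1≤i≤m} ( Re(tr((P_i − P₀)* X)) + c_i − c₀ ) over the set B(n) = {X ∈ M_n(ℂ) : X X* ⪯ I_n}. Then the set of optimal solutions of this problem contains a unitary matrix; i.e., there exists U ∈ U(n) ⊆ B(n) with min_{1≤i≤m}( Re(tr((P_i − P₀)* U)) + c_i − c₀ ) = sup_{X ∈ B(n)} min_{1≤i≤m}( Re(tr((P_i − P₀)* X)) + c_i − c₀ ). -/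
open Matrix Finset
open scoped ComplexOrder

/-- The real inner product `⟨X,Y⟩ = Re(tr(Xᴴ Y))` on `n × n` complex matrices. -/
noncomputable def finner {n : ℕ} (X Y : Matrix (Fin n) (Fin n) ℂ) : ℝ :=
  ((Xᴴ * Y).trace).re

/-- `B(n)`: the set of `n × n` complex matrices `X` with `X Xᴴ ⪯ Iₙ`. -/
def Bset (n : ℕ) : Set (Matrix (Fin n) (Fin n) ℂ) :=
  {X | (1 - X * Xᴴ).PosSemidef}

section CStarAlgebra

variable {A : Type*} [CStarAlgebra A] [PartialOrder A] [StarOrderedRing A]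

open scoped ComplexStarModule

/-- A contraction in a unital C⋆-algebra can be lowered to a unitary by subtracting a
nonnegative element. -/
lemma CStarAlgebra.exists_unitary_sub_nonneg (a : A) (ha : ‖a‖ ≤ 1) :
    ∃ u ∈ unitary A, 0 ≤ a - u := by
  set r : A := (ℜ a : A)
  set s : A := (ℑ a : A)
  have hr : IsSelfAdjoint r := (ℜ a).2
  have hs : IsSelfAdjoint s := (ℑ a).2
  have hs_norm : ‖s‖ ≤ 1 := (imaginaryPart.norm_le a).trans ha
  have hsum : star a * a + a * star a = (2 : ℝ) • (r ^ 2 + s ^ 2) := by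
    rw [sq, sq, two_smul, star_mul_self_add_self_mul_star, two_nsmul]
  have hle : star a * a ≤ 1 := by
    rw [← CStarAlgebra.norm_le_one_iff_of_nonneg _ (star_mul_self_nonneg a),
      CStarRing.norm_star_mul_self]
    exact mul_le_one₀ ha (norm_nonneg _) ha
  have hle' : a * star a ≤ 1 := by
    rw [← CStarAlgebra.norm_le_one_iff_of_nonneg _ (mul_star_self_nonneg a),
      CStarRing.norm_self_mul_star]
    exact mul_le_one₀ ha (norm_nonneg _) ha
  have hrs : r ^ 2 ≤ 1 - s ^ 2 := by
    rw [le_sub_iff_add_le]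
    have h : (2 : ℝ) • (r ^ 2 + s ^ 2) ≤ (2 : ℝ) • (1 : A) := by
      rw [← hsum, two_smul]
      exact add_le_add hle hle'
    exact le_of_smul_le_smul_left h two_pos
  have hneg : -r ≤ CFC.sqrt (1 - s ^ 2) :=
    calc -r ≤ CFC.abs r := by
          rw [neg_le_iff_add_nonneg', add_comm, CFC.abs_add_self r hr]
          exact smul_nonneg zero_le_two (CFC.posPart_nonneg r)
      _ = CFC.sqrt (r ^ 2) := by rw [CFC.abs, hr.star_eq, sq]
      _ ≤ CFC.sqrt (1 - s ^ 2) := CFC.sqrt_le_sqrt _ _ hrs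
  have hI : Complex.I • (1 : A) ∈ unitary A := by
    simp [Unitary.mem_iff, smul_smul]
  refine ⟨Complex.I • 1 * (s + Complex.I • CFC.sqrt (1 - s ^ 2)),
    mul_mem hI (hs.self_add_I_smul_cfcSqrt_sub_sq_mem_unitary s hs_norm), ?_⟩
  have ha_eq : r + Complex.I • s = a := realPart_add_I_smul_imaginaryPart a
  have : a - Complex.I • 1 * (s + Complex.I • CFC.sqrt (1 - s ^ 2))
      = r + CFC.sqrt (1 - s ^ 2) := by
    rw [← ha_eq, smul_mul_assoc, one_mul, smul_add, smul_smul, Complex.I_mul_I, neg_one_smul]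
    abel
  rw [this]
  exact neg_le_iff_add_nonneg'.mp hneg

end CStarAlgebra

namespace Matrix

variable {ι : Type*} [Fintype ι] [DecidableEq ι]

lemma re_trace_mul_le_of_mem_unitaryGroup {V H : Matrix ι ι ℂ} (hV : V ∈ unitaryGroup ι ℂ)
    (hH : H.PosSemidef) : (V * H).trace.re ≤ H.trace.re := by
  have hVV : Vᴴ * V = 1 := mem_unitaryGroup_iff'.mp hV
  have hpos : 0 ≤ ((V - 1) * H * (V - 1)ᴴ).trace.re :=
    (Complex.nonneg_iff.mp (hH.mul_mul_conjTranspose_same (V - 1)).trace_nonneg).1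
  have hconj : (Vᴴ * H).trace.re = (V * H).trace.re := by
    rw [← Complex.conj_re, starRingEnd_apply, ← trace_conjTranspose, conjTranspose_mul,
      conjTranspose_conjTranspose, hH.isHermitian.eq, trace_mul_comm]
  have hexp : ((V - 1) * H * (V - 1)ᴴ).trace
      = 2 * H.trace - (V * H).trace - (Vᴴ * H).trace := by
    rw [trace_mul_comm, ← mul_assoc, conjTranspose_sub, conjTranspose_one,
      show (Vᴴ - 1) * (V - 1) = 2 • 1 - V - Vᴴ by
        rw [sub_mul, mul_sub, hVV, two_smul]; simp; abel]
    simp [sub_mul, two_mul, two_smul, add_mul]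
  rw [hexp] at hpos
  simp only [Complex.sub_re, Complex.mul_re, hconj] at hpos
  norm_num at hpos
  linarith

end Matrix

section Contractions

variable {n : ℕ}

open scoped Matrix.Norms.L2Operator MatrixOrder

lemma mem_Bset_iff_norm_le_one {X : Matrix (Fin n) (Fin n) ℂ} : X ∈ Bset n ↔ ‖X‖ ≤ 1 := by
  rw [← sq_le_one_iff₀ (norm_nonneg X), sq, ← CStarRing.norm_self_mul_star (x := X),
    CStarAlgebra.norm_le_one_iff_of_nonneg _ (mul_star_self_nonneg X)]
  exact Matrix.le_iff.symm

lemma isCompact_Bset : IsCompact (Bset n) := by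
  have hball : Bset n = Metric.closedBall 0 1 := by
    ext X
    rw [mem_Bset_iff_norm_le_one, mem_closedBall_zero_iff]
  have := FiniteDimensional.proper ℂ (Matrix (Fin n) (Fin n) ℂ)
  rw [hball]
  exact isCompact_closedBall 0 1

lemma mem_Bset_of_mem_unitaryGroup {U : Matrix (Fin n) (Fin n) ℂ}
    (hU : U ∈ Matrix.unitaryGroup (Fin n) ℂ) : U ∈ Bset n := by
  have h : U * Uᴴ = 1 := Matrix.mem_unitaryGroup_iff.mp hU
  rw [Bset, Set.mem_ofPred_eq, h, sub_self]
  exact Matrix.PosSemidef.zero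

lemma exists_unitary_add_mul_posSemidef {Q X : Matrix (Fin n) (Fin n) ℂ}
    (hQ : Q ∈ Matrix.unitaryGroup (Fin n) ℂ) (hX : X ∈ Bset n) :
    ∃ U ∈ Matrix.unitaryGroup (Fin n) ℂ,
      ∃ H : Matrix (Fin n) (Fin n) ℂ, H.PosSemidef ∧ X = U + Q * H := by
  have hnorm : ‖Qᴴ * X‖ ≤ 1 := by
    have hQ' : ‖star Q‖ ≤ 1 := by
      rw [norm_star]
      exact mem_Bset_iff_norm_le_one.mp (mem_Bset_of_mem_unitaryGroup hQ)
    exact (norm_mul_le _ _).trans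
      (mul_le_one₀ hQ' (norm_nonneg _) (mem_Bset_iff_norm_le_one.mp hX))
  obtain ⟨W, hW, hle⟩ := CStarAlgebra.exists_unitary_sub_nonneg (Qᴴ * X) hnorm
  refine ⟨Q * W, mul_mem hQ hW, Qᴴ * X - W, Matrix.nonneg_iff_posSemidef.mp hle, ?_⟩
  have hQQ : Q * Qᴴ = 1 := Matrix.mem_unitaryGroup_iff.mp hQ
  rw [mul_sub, ← mul_assoc, hQQ, one_mul, add_sub_cancel]

end Contractions

lemma continuous_finner_right {n : ℕ} (Y : Matrix (Fin n) (Fin n) ℂ) :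
    Continuous (finner Y) :=
  Complex.continuous_re.comp (continuous_const.matrix_mul continuous_id).matrix_trace

lemma finner_sub_mul_nonpos {n : ℕ} {P Q H : Matrix (Fin n) (Fin n) ℂ}
    (hP : P ∈ Matrix.unitaryGroup (Fin n) ℂ) (hQ : Q ∈ Matrix.unitaryGroup (Fin n) ℂ)
    (hH : H.PosSemidef) : finner (P - Q) (Q * H) ≤ 0 := by
  have hQQ : Qᴴ * Q = 1 := Matrix.mem_unitaryGroup_iff'.mp hQ
  have h := Matrix.re_trace_mul_le_of_mem_unitaryGroup
    (mul_mem (Unitary.star_mem hP) hQ) hH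
  rw [finner, conjTranspose_sub, sub_mul, ← mul_assoc, ← mul_assoc, hQQ, one_mul, trace_sub,
    Complex.sub_re]
  exact sub_nonpos.mpr h

/-- The optimization problem `max_{X ∈ B(n)} min_{1 ≤ i ≤ m} (⟨Pᵢ - P₀, X⟩ + cᵢ - c₀)`
has an optimal solution which is a unitary matrix. -/
theorem unitary_maximizer_of_minimum_of_affine (n m : ℕ) (hn : 1 ≤ n) (hm : 1 ≤ m)
    (P : ℕ → Matrix (Fin n) (Fin n) ℂ)
    (hP : ∀ i ≤ m, P i ∈ Matrix.unitaryGroup (Fin n) ℂ) (c : ℕ → ℝ) :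
    ∃ U ∈ Matrix.unitaryGroup (Fin n) ℂ, U ∈ Bset n ∧
      ∀ X ∈ Bset n,
        (Finset.Icc 1 m).inf' (Finset.nonempty_Icc.mpr hm)
            (fun i => finner (P i - P 0) X + c i - c 0) ≤
          (Finset.Icc 1 m).inf' (Finset.nonempty_Icc.mpr hm)
            (fun i => finner (P i - P 0) U + c i - c 0) := by
  obtain ⟨X, hX, hmax⟩ := isCompact_Bset.exists_isMaxOn
    ⟨1, mem_Bset_of_mem_unitaryGroup (one_mem (Matrix.unitaryGroup (Fin n) ℂ))⟩
    (f := fun X => (Finset.Icc 1 m).inf' (Finset.nonempty_Icc.mpr hm)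
      (fun i => finner (P i - P 0) X + c i - c 0))
    (Continuous.finset_inf'_apply _ fun i _ =>
      ((continuous_finner_right (P i - P 0)).add_const (c i)).sub continuous_const).continuousOn
  obtain ⟨U, hU, H, hH, rfl⟩ := exists_unitary_add_mul_posSemidef (hP 0 m.zero_le) hX
  refine ⟨U, hU, mem_Bset_of_mem_unitaryGroup hU, fun Y hY => (hmax hY).trans ?_⟩
  refine Finset.inf'_mono_fun fun i hi => ?_
  have h := finner_sub_mul_nonpos (hP i (Finset.mem_Icc.mp hi).2) (hP 0 m.zero_le) hH
  have hadd : finner (P i - P 0) (U + P 0 * H)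
      = finner (P i - P 0) U + finner (P i - P 0) (P 0 * H) := by
    simp only [finner, mul_add, trace_add, Complex.add_re]
  rw [hadd]
  linarith
end

section
/- Let n ≥ 1, let P₀, P₁, …, P_m be n×n unitary matrices and c₀, c₁, …, c_m be real numbers. Then sup_{X ∈ B(n)} min_{1≤i≤m}( Re(tr((P_i − P₀)* X)) + c_i − c₀ ) = sup_{X ∈ U(n)} min_{1≤i≤m}( Re(tr((P_i − P₀)* X)) + c_i − c₀ ); i.e., the convex relaxation of the optimization over the unitary group obtained by replacing U(n) with B(n) is exact. -/
open Matrix Finset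
open scoped ComplexOrder

section CStarAlgebra

variable {A : Type*} [CStarAlgebra A] [PartialOrder A] [StarOrderedRing A]

/-- An operator-monotonicity consequence: `a² ≤ c` implies `a ≤ √c` for self-adjoint `a`. -/
lemma IsSelfAdjoint.le_sqrt_of_mul_self_le {a c : A} (ha : IsSelfAdjoint a) (h : a * a ≤ c) :
    a ≤ CFC.sqrt c :=
  calc a ≤ CFC.abs a := by
        rw [← sub_nonneg, CFC.abs_sub_self a ha]
        exact nsmul_nonneg (CFC.negPart_nonneg a) 2
    _ ≤ CFC.sqrt c := CFC.sqrt_le_sqrt _ _ (by rwa [ha.star_eq])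

lemma star_mul_self_le_one_of_mul_star_self_le_one {x : A} (h : x * star x ≤ 1) :
    star x * x ≤ 1 := by
  rw [← CStarAlgebra.norm_le_one_iff_of_nonneg _ (star_mul_self_nonneg x),
    CStarRing.norm_star_mul_self, ← CStarRing.norm_self_mul_star]
  rwa [CStarAlgebra.norm_le_one_iff_of_nonneg _ (mul_star_self_nonneg x)]

/-- Every contraction lies below a unitary with the same imaginary part. -/
lemma exists_unitary_ge_of_mul_star_self_le_one {x : A} (h : x * star x ≤ 1) :
    ∃ u ∈ unitary A, x ≤ u := by
  obtain ⟨a, b, ha, hb, rfl⟩ : ∃ a b : A, IsSelfAdjoint a ∧ IsSelfAdjoint b ∧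
      x = a + Complex.I • b :=
    ⟨realPart x, imaginaryPart x, (realPart x).2, (imaginaryPart x).2,
      (realPart_add_I_smul_imaginaryPart x).symm⟩
  have hsum : (2 : ℝ) • (a * a + b * b) ≤ (2 : ℝ) • 1 := by
    have := add_le_add h (star_mul_self_le_one_of_mul_star_self_le_one h)
    convert this using 1
    · simp only [star_add, star_smul, ha.star_eq, hb.star_eq, add_mul, mul_add, smul_add,
        smul_mul_assoc, mul_smul_comm, smul_smul, two_smul, RCLike.star_def, Complex.conj_I, neg_mul,
        mul_neg, Complex.I_mul_I, neg_smul, smul_neg, one_smul, neg_neg]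
      abel
    · exact two_smul ℝ 1
  have hab : a * a ≤ 1 - b * b :=
    le_sub_iff_add_le.mpr ((smul_le_smul_iff_of_pos_left two_pos).mp hsum)
  have h0 : 0 ≤ 1 - b * b := (by simpa [ha.star_eq] using star_mul_self_nonneg a :
    0 ≤ a * a).trans hab
  set s := CFC.sqrt (1 - b * b)
  have hs : star s = s := (CFC.sqrt_nonneg _).isSelfAdjoint
  have hss : s * s = 1 - b * b := CFC.sqrt_mul_sqrt_self _ h0
  have hsb : Commute s b :=
    Commute.cfcₙ_nnreal (.sub_left (.one_left b) (.mul_left (.refl b) (.refl b))) _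
  refine ⟨s + Complex.I • b, ?_, by gcongr; exact ha.le_sqrt_of_mul_self_le hab⟩
  rw [Unitary.mem_iff]
  constructor <;>
  · simp only [star_add, star_smul, hs, hb.star_eq, add_mul, mul_add, smul_add, smul_mul_assoc,
      mul_smul_comm, smul_smul, RCLike.star_def, Complex.conj_I, neg_mul, mul_neg,
      Complex.I_mul_I, neg_smul, smul_neg, one_smul, neg_neg, hss, hsb.eq]
    abel

end CStarAlgebra

namespace Matrix

variable {n : Type*} [Fintype n] [DecidableEq n]

lemma exists_unitary_sub_posSemidef {X : Matrix n n ℂ} (h : (1 - X * Xᴴ).PosSemidef) :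
    ∃ U ∈ unitaryGroup n ℂ, (U - X).PosSemidef := by
  open scoped MatrixOrder Matrix.Norms.L2Operator in
  exact exists_unitary_ge_of_mul_star_self_le_one (x := X) h

lemma PosSemidef.re_trace_unitary_mul_le {K W : Matrix n n ℂ} (hK : K.PosSemidef)
    (hW : W ∈ unitaryGroup n ℂ) : (W * K).trace.re ≤ K.trace.re := by
  have hW' : Wᴴ * W = 1 := mem_unitaryGroup_iff'.mp hW
  have h := (Complex.le_def.mp (hK.mul_mul_conjTranspose_same (1 - W)).trace_nonneg).1
  have hconj : (K * Wᴴ).trace.re = (W * K).trace.re := by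
    rw [← Complex.conj_re (W * K).trace, ← Complex.star_def, ← trace_conjTranspose,
      conjTranspose_mul, hK.1.eq]
  have hcyc : (W * K * Wᴴ).trace = K.trace := by
    rw [trace_mul_comm, ← Matrix.mul_assoc, hW', Matrix.one_mul]
  simp only [conjTranspose_sub, conjTranspose_one, Matrix.sub_mul, Matrix.mul_sub, Matrix.one_mul,
    Matrix.mul_one, trace_sub, hcyc, Complex.sub_re, hconj, Complex.zero_re] at h
  linarith

end Matrix

lemma unitaryGroup_subset_Bset (n : ℕ) :
    (Matrix.unitaryGroup (Fin n) ℂ : Set (Matrix (Fin n) (Fin n) ℂ)) ⊆ Bset n := by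
  intro U hU
  have h : U * Uᴴ = 1 := Matrix.mem_unitaryGroup_iff.mp hU
  simpa [Bset, h] using Matrix.PosSemidef.zero

/-- Moving a contraction `X` in a suitable direction `-Q K`, with `K` positive semidefinite,
reaches a unitary without decreasing `⟨R - Q, ·⟩` for any unitary `R`. -/
lemma exists_unitary_finner_le {n : ℕ} {Q X : Matrix (Fin n) (Fin n) ℂ}
    (hQ : Q ∈ Matrix.unitaryGroup (Fin n) ℂ) (hX : X ∈ Bset n) :
    ∃ U ∈ Matrix.unitaryGroup (Fin n) ℂ, ∀ R ∈ Matrix.unitaryGroup (Fin n) ℂ,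
      finner (R - Q) X ≤ finner (R - Q) U := by
  have hQ₁ : Qᴴ * Q = 1 := Matrix.mem_unitaryGroup_iff'.mp hQ
  have hQ₂ : Q * Qᴴ = 1 := Matrix.mem_unitaryGroup_iff.mp hQ
  have hY : (1 - (-(Qᴴ * X)) * (-(Qᴴ * X))ᴴ).PosSemidef := by
    have h := Matrix.PosSemidef.conjTranspose_mul_mul_same hX Q
    simpa [Matrix.mul_sub, Matrix.sub_mul, hQ₁, Matrix.mul_assoc] using h
  obtain ⟨V, hV, hK⟩ := Matrix.exists_unitary_sub_posSemidef hY
  refine ⟨-(Q * V), ?_, fun R hR => ?_⟩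
  · have h : V * Vᴴ = 1 := Matrix.mem_unitaryGroup_iff.mp hV
    rw [Matrix.mem_unitaryGroup_iff, Matrix.star_eq_conjTranspose]
    simp only [Matrix.conjTranspose_neg, Matrix.conjTranspose_mul, neg_mul_neg]
    rw [Matrix.mul_assoc, ← Matrix.mul_assoc V, h, Matrix.one_mul, hQ₂]
  · have h := hK.re_trace_unitary_mul_le (mul_mem (Unitary.star_mem hR) hQ)
    have e : Rᴴ * Q * (V - -(Qᴴ * X)) = Rᴴ * (Q * V) + Rᴴ * X := by
      rw [sub_neg_eq_add, Matrix.mul_add, Matrix.mul_assoc, Matrix.mul_assoc,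
        ← Matrix.mul_assoc Q, hQ₂, Matrix.one_mul]
    rw [Matrix.star_eq_conjTranspose, e] at h
    simp only [finner, Matrix.conjTranspose_sub, Matrix.sub_mul, Matrix.mul_neg,
      ← Matrix.mul_assoc Qᴴ, hQ₁, Matrix.one_mul, Matrix.trace_sub, Matrix.trace_neg,
      Matrix.trace_add, Complex.add_re, Complex.sub_re, Complex.neg_re, sub_neg_eq_add] at h ⊢
    linarith

/-- The relaxation over `B(n)` of the maximization over the unitary group `U(n)` of
`X ↦ min_{1 ≤ i ≤ m} (⟨Pᵢ - P₀, X⟩ + cᵢ - c₀)` is exact. -/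
theorem sSup_Bset_eq_sSup_unitaryGroup (n m : ℕ) (hn : 1 ≤ n) (hm : 1 ≤ m)
    (P : ℕ → Matrix (Fin n) (Fin n) ℂ)
    (hP : ∀ i ≤ m, P i ∈ Matrix.unitaryGroup (Fin n) ℂ) (c : ℕ → ℝ) :
    sSup ((fun X => (Finset.Icc 1 m).inf' (Finset.nonempty_Icc.mpr hm)
          (fun i => finner (P i - P 0) X + c i - c 0)) '' Bset n) =
      sSup ((fun X => (Finset.Icc 1 m).inf' (Finset.nonempty_Icc.mpr hm)
          (fun i => finner (P i - P 0) X + c i - c 0)) ''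
            (Matrix.unitaryGroup (Fin n) ℂ : Set (Matrix (Fin n) (Fin n) ℂ))) := by
  apply csSup_eq_csSup_of_forall_exists_le
  · rintro _ ⟨X, hX, rfl⟩
    obtain ⟨U, hU, h⟩ := exists_unitary_finner_le (hP 0 (Nat.zero_le m)) hX
    refine ⟨_, ⟨U, hU, rfl⟩, Finset.inf'_mono_fun fun i hi => ?_⟩
    linarith [h (P i) (hP i (Finset.mem_Icc.mp hi).2)]
  · rintro _ ⟨U, hU, rfl⟩
    exact ⟨_, ⟨U, unitaryGroup_subset_Bset n hU, rfl⟩, le_rfl⟩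
end

section
/- Let 1 ≤ k ≤ n and let Σ ∈ M_n(ℂ) be a diagonal matrix with positive real diagonal entries (λ₁, …, λ_n) such that λ_j = 1 for all j = 1, …, k−1 and λ_j < 1 for all j = k, …, n. Then every matrix X ∈ M_n(ℂ), written in block form X = [[X₁, X₂],[X₃, X₄]] with X₁ the top-left (k−1)×(k−1) block, such that −X₁ − X₁* is positive definite, belongs to the tangent cone T_{B(n)}(Σ) = cl{ λ(Z − Σ) : λ ≥ 0, Z ∈ B(n) }. -/
open Matrix Finset
open scoped ComplexOrder

/-- The tangent cone to `B(n)` at `X ∈ B(n)`: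
`cl { λ (Z - X) : λ ≥ 0, Z ∈ B(n) }`. -/
def tangentConeBset (n : ℕ) (X : Matrix (Fin n) (Fin n) ℂ) : Set (Matrix (Fin n) (Fin n) ℂ) :=
  closure {Y | ∃ l : ℝ, 0 ≤ l ∧ ∃ Z ∈ Bset n, Y = l • (Z - X)}

open Filter Topology in
/-- If the Hermitian matrix `H` is positive on the isotropic vectors of the positive semidefinite
matrix `A`, then `A + t H + t² Q` is positive semidefinite for all small `t > 0`. -/
theorem Matrix.PosSemidef.eventually_add_smul_add_sq_smul {ι : Type*} [Fintype ι]
    {A H Q : Matrix ι ι ℂ} (hA : A.PosSemidef) (hH : H.IsHermitian) (hQ : Q.IsHermitian)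
    (h : ∀ v : ι → ℂ, v ≠ 0 → star v ⬝ᵥ A *ᵥ v = 0 → 0 < star v ⬝ᵥ H *ᵥ v) :
    ∀ᶠ t : ℝ in 𝓝[>] 0, (A + t • H + t ^ 2 • Q).PosSemidef := by
  have hcont : ∀ M : Matrix ι ι ℂ,
      Continuous fun z : ℝ × (ι → ℂ) => (star z.2 ⬝ᵥ M *ᵥ z.2).re := fun M => by fun_prop
  have hexp : ∀ (t : ℝ) (v : ι → ℂ), (star v ⬝ᵥ (A + t • H + t ^ 2 • Q) *ᵥ v).re =
      (star v ⬝ᵥ A *ᵥ v).re + t * ((star v ⬝ᵥ H *ᵥ v).re + t * (star v ⬝ᵥ Q *ᵥ v).re) := by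
    intro t v
    simp only [add_mulVec, smul_mulVec, dotProduct_add, dotProduct_smul, Complex.add_re,
      Complex.smul_re, smul_eq_mul]
    ring
  have hev : ∀ᶠ t : ℝ in 𝓝 0, ∀ v ∈ Metric.sphere (0 : ι → ℂ) 1, 0 < t →
      0 ≤ (star v ⬝ᵥ (A + t • H + t ^ 2 • Q) *ᵥ v).re := by
    refine (isCompact_sphere (0 : ι → ℂ) 1).eventually_forall_of_forall_eventually
      fun v hv => ?_
    have hv0 : v ≠ 0 := by
      rintro rfl
      simp at hv
    have hAv := hA.dotProduct_mulVec_nonneg v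
    by_cases hz : star v ⬝ᵥ A *ᵥ v = 0
    · have hc : ContinuousAt (fun z : ℝ × (ι → ℂ) =>
          (star z.2 ⬝ᵥ H *ᵥ z.2).re + z.1 * (star z.2 ⬝ᵥ Q *ᵥ z.2).re) (0, v) :=
        ((hcont H).add (continuous_fst.mul (hcont Q))).continuousAt
      have hpos : 0 < (star v ⬝ᵥ H *ᵥ v).re + (0 : ℝ) * (star v ⬝ᵥ Q *ᵥ v).re := by
        simpa using (Complex.pos_iff.1 (h v hv0 hz)).1
      filter_upwards [hc.eventually (lt_mem_nhds hpos)] with z hz' ht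
      rw [hexp]
      exact add_nonneg (Complex.nonneg_iff.1 (hA.dotProduct_mulVec_nonneg z.2)).1
        (mul_nonneg ht.le hz'.le)
    · have hc : ContinuousAt (fun z : ℝ × (ι → ℂ) => (star z.2 ⬝ᵥ A *ᵥ z.2).re +
          z.1 * ((star z.2 ⬝ᵥ H *ᵥ z.2).re + z.1 * (star z.2 ⬝ᵥ Q *ᵥ z.2).re)) (0, v) :=
        ((hcont A).add (continuous_fst.mul
          ((hcont H).add (continuous_fst.mul (hcont Q))))).continuousAt
      have hpos : 0 < (star v ⬝ᵥ A *ᵥ v).re +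
          (0 : ℝ) * ((star v ⬝ᵥ H *ᵥ v).re + (0 : ℝ) * (star v ⬝ᵥ Q *ᵥ v).re) := by
        simpa using (Complex.pos_iff.1 (lt_of_le_of_ne hAv (Ne.symm hz))).1
      filter_upwards [hc.eventually (lt_mem_nhds hpos)] with z hz' _
      rw [hexp]
      exact hz'.le
  filter_upwards [hev.filter_mono nhdsWithin_le_nhds, self_mem_nhdsWithin] with t ht ht0
  have hherm : (A + t • H + t ^ 2 • Q).IsHermitian :=
    (hA.1.add (hH.smul (IsSelfAdjoint.all t))).add (hQ.smul (IsSelfAdjoint.all (t ^ 2)))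
  refine .of_dotProduct_mulVec_nonneg hherm fun v => Complex.nonneg_iff.2
    ⟨?_, (hherm.im_star_dotProduct_mulVec_self v).symm⟩
  rcases eq_or_ne v 0 with rfl | hv
  · simp
  have hu := ht (‖v‖⁻¹ • v) (by simp [norm_smul, hv]) ht0
  rw [star_smul, mulVec_smul, dotProduct_smul, smul_dotProduct, smul_smul, Complex.smul_re,
    smul_eq_mul] at hu
  refine nonneg_of_mul_nonneg_right hu ?_
  have : 0 < ‖v‖⁻¹ := inv_pos.2 (norm_pos_iff.2 hv)
  simpa using this

/-- The quadratic form of a matrix at a vector supported on the range of an injection `e` is that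
of the principal submatrix indexed by `e`. -/
theorem Matrix.star_dotProduct_submatrix_mulVec {ι κ R : Type*} [Fintype ι] [Fintype κ]
    [NonUnitalSemiring R] [StarRing R] (M : Matrix κ κ R) {e : ι → κ}
    (he : Function.Injective e) {v : κ → R} (hv : ∀ j ∉ Set.range e, v j = 0) :
    star (v ∘ e) ⬝ᵥ M.submatrix e e *ᵥ (v ∘ e) = star v ⬝ᵥ M *ᵥ v := by
  refine Fintype.sum_of_injective e he _ _ (fun j hj => by simp [hv j hj]) fun i => ?_
  congr 1
  exact Fintype.sum_of_injective e he _ _ (fun j hj => by simp [hv j hj]) fun _ => rfl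

/-- Let `1 ≤ k ≤ n` and `Σ = diag(λ₁, …, λₙ)` with positive real entries such that
`λⱼ = 1` for the first `k - 1` indices and `λⱼ < 1` for the remaining ones.  Any matrix `X`
whose top-left `(k-1) × (k-1)` block `X₁` satisfies `-X₁ - X₁ᴴ ≻ 0` belongs to the tangent
cone of `B(n)` at `Σ`. -/
theorem mem_tangentCone_of_block_negDef (n k : ℕ) (hk1 : 1 ≤ k) (hkn : k ≤ n)
    (lam : Fin n → ℝ) (hpos : ∀ j, 0 < lam j)
    (h1 : ∀ j : Fin n, (j : ℕ) < k - 1 → lam j = 1)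
    (h2 : ∀ j : Fin n, k - 1 ≤ (j : ℕ) → lam j < 1)
    (X : Matrix (Fin n) (Fin n) ℂ)
    (hX : (-(X.submatrix (Fin.castLE (show k - 1 ≤ n by omega))
              (Fin.castLE (show k - 1 ≤ n by omega))) -
           (X.submatrix (Fin.castLE (show k - 1 ≤ n by omega))
              (Fin.castLE (show k - 1 ≤ n by omega)))ᴴ).PosDef) :
    X ∈ tangentConeBset n (Matrix.diagonal (fun j => (lam j : ℂ))) := by
  set D : Matrix (Fin n) (Fin n) ℂ := diagonal fun j => (lam j : ℂ) with hD
  set e : Fin (k - 1) → Fin n := Fin.castLE (show k - 1 ≤ n by omega)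
  have he_inj : Function.Injective e := Fin.castLE_injective _
  have hrange : ∀ j : Fin n, j ∉ Set.range e → k - 1 ≤ (j : ℕ) := fun j hj => by
    by_contra! hlt
    exact hj ⟨⟨j, hlt⟩, rfl⟩
  have hDH : Dᴴ = D := by
    simp [hD, diagonal_conjTranspose, Pi.star_def]
  have hdiag : 1 - D * D = diagonal fun j => ((1 - lam j ^ 2 : ℝ) : ℂ) := by
    rw [hD, diagonal_mul_diagonal, ← diagonal_one, diagonal_sub]
    simp [sq]
  have hle : ∀ j, lam j ≤ 1 := fun j =>
    (lt_or_ge (j : ℕ) (k - 1)).elim (fun hj => (h1 j hj).le) fun hj => (h2 j hj).le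
  have hA : (1 - D * D).PosSemidef := by
    rw [hdiag, posSemidef_diagonal_iff]
    intro j
    rw [Complex.zero_le_real]
    nlinarith [hpos j, hle j]
  have hH : (-(D * Xᴴ) - X * D).IsHermitian := by
    simp [IsHermitian, hDH, sub_eq_add_neg, add_comm]
  have hQ : (-(X * Xᴴ)).IsHermitian := (isHermitian_mul_conjTranspose_self X).neg
  have hpos_ker : ∀ v : Fin n → ℂ, v ≠ 0 → star v ⬝ᵥ (1 - D * D) *ᵥ v = 0 →
      0 < star v ⬝ᵥ (-(D * Xᴴ) - X * D) *ᵥ v := by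
    intro v hv0 hv
    rw [hA.dotProduct_mulVec_zero_iff, hdiag] at hv
    have hsupp : ∀ j ∉ Set.range e, v j = 0 := fun j hj => by
      have hj' := congrFun hv j
      rw [mulVec_diagonal] at hj'
      refine (mul_eq_zero.1 hj').resolve_left (Complex.ofReal_ne_zero.2 ?_)
      nlinarith [hpos j, h2 j (hrange j hj)]
    have hDv : D *ᵥ v = v := by
      ext j
      rw [hD, mulVec_diagonal]
      by_cases hj : (j : ℕ) < k - 1
      · simp [h1 j hj]
      · have : j ∉ Set.range e := by
          rintro ⟨i, rfl⟩
          exact hj i.2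
        simp [hsupp j this]
    have hvD : star v ᵥ* D = star v := by
      rw [← hDH, ← star_mulVec, hDv]
    have hform : star v ⬝ᵥ (-(D * Xᴴ) - X * D) *ᵥ v = star v ⬝ᵥ (-X - Xᴴ) *ᵥ v := by
      simp only [sub_mulVec, neg_mulVec, dotProduct_sub, dotProduct_neg, ← mulVec_mulVec, hDv]
      rw [dotProduct_mulVec _ D, hvD]
      ring
    rw [hform, ← star_dotProduct_submatrix_mulVec _ he_inj hsupp]
    refine hX.dotProduct_mulVec_pos fun hzero => hv0 <| funext fun j => ?_
    by_cases hj : j ∈ Set.range e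
    · obtain ⟨i, rfl⟩ := hj
      exact congrFun hzero i
    · exact hsupp j hj
  obtain ⟨t, ht, ht0⟩ :=
    ((hA.eventually_add_smul_add_sq_smul hH hQ hpos_ker).and self_mem_nhdsWithin).exists
  have ht0 : 0 < t := ht0
  refine subset_closure ⟨t⁻¹, (inv_pos.2 ht0).le, D + t • X, ?_, ?_⟩
  · have hexpand : 1 - (D + t • X) * (D + t • X)ᴴ =
        1 - D * D + t • (-(D * Xᴴ) - X * D) + t ^ 2 • (-(X * Xᴴ)) := by
      simp only [conjTranspose_add, conjTranspose_smul, hDH, star_trivial, add_mul, mul_add,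
        Matrix.smul_mul, Matrix.mul_smul, smul_smul, smul_sub, smul_neg, ← sq]
      abel
    rw [Bset, Set.mem_ofPred_eq, hexpand]
    exact ht
  · rw [add_sub_cancel_left, smul_smul, inv_mul_cancel₀ ht0.ne', one_smul]
end
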